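/- arXiv:1910.09246 — 2 statements merged into one kernel-verified Lean document; each statement's English description precedes it below -/
import Mathlib

section
/- Let C = {0, 1} be a binary class set, S a finite dataset in which both classes are nonempty, c : S → C the true-class function, and m a scoring model whose top-scoring class 𝐦(x) is uniquely attained for every x ∈ S. Define the confusion counts tp = |{x ∈ S : c(x)=1 ∧ 𝐦(x)=1}|, fn = |{x ∈ S : c(x)=1 ∧ 𝐦(x)=0}|, fp = |{x ∈ S : c(x)=0 ∧ 𝐦(x)=1}|, tn = |{x ∈ S : c(x)=0 ∧ 𝐦(x)=0}|. If τ = 1/2 and the complexity function is constant (d(x) = κ > 0 for all x), then for any priorities p(0), p(1) ∈ [0,1] with p(0)+p(1) = 1, the H-accuracy equals Ha(m | 1/2, p, d) = p(0)·tn/(tn+fp) + p(1)·tp/(tp+fn). -/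
open Finset

/-- Number of instances with true class `a` that the classifier labels `b`. -/
def confCount {X : Type*} [Fintype X] (c m : X → Bool) (a b : Bool) : ℕ :=
  (univ.filter (fun x => c x = a ∧ m x = b)).card

/-- The per-class contribution is the class recall. -/
theorem class_rate {X : Type*} [Fintype X] (c : X → Bool) (hclass : ∀ l : Bool, ∃ x : X, c x = l)
    (score : X → Bool → ℝ) (argmax : X → Bool)
    (hmax : ∀ x l, score x l ≤ score x (argmax x))
    (huniq : ∀ x l, score x l = score x (argmax x) → l = argmax x)
    (d : X → ℝ) (κ : ℝ) (hκ : 0 < κ) (hd : ∀ x, d x = κ) (l : Bool) :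
    (∑ x ∈ univ.filter (fun x => c x = l),
          (d x / ∑ x' ∈ univ.filter (fun x' => c x' = l), d x') *
            (if score x (argmax x) ≤ score x l then (1 : ℝ) else 0))
      = (confCount c argmax l l : ℝ) /
        ((confCount c argmax l l : ℝ) + (confCount c argmax l (!l) : ℝ)) := by
  have hind : ∀ x, (score x (argmax x) ≤ score x l) ↔ argmax x = l := by
    intro x
    constructor
    · intro h
      exact (huniq x l (le_antisymm (hmax x l) h)).symm
    · rintro rfl
      exact le_rfl
  have hsum : confCount c argmax l l + confCount c argmax l (!l)
      = (univ.filter (fun x => c x = l)).card := by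
    have h := Finset.card_filter_add_card_filter_not
      (s := univ.filter (fun x => c x = l)) (fun x => argmax x = l)
    rw [Finset.filter_filter, Finset.filter_filter] at h
    rw [← h]
    unfold confCount
    congr 3
    ext x
    cases argmax x <;> cases l <;> simp
  have hpos : (0 : ℝ) < ((univ.filter (fun x => c x = l)).card : ℝ) := by
    obtain ⟨x, hx⟩ := hclass l
    exact_mod_cast Finset.card_pos.mpr ⟨x, by simp [hx]⟩
  have hs : (confCount c argmax l l : ℝ) + (confCount c argmax l (!l) : ℝ)
      = ((univ.filter (fun x => c x = l)).card : ℝ) := by exact_mod_cast hsum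
  rw [hs]
  simp only [hind, hd]
  rw [← Finset.mul_sum, Finset.sum_boole, Finset.filter_filter, Finset.sum_const, nsmul_eq_mul]
  unfold confCount
  field_simp

/-- In the binary case, with τ = 1/2 (so the penalty σ is the indicator
that the true-class score attains the maximal score) and constant complexity, the
H-accuracy equals p(0)·tn/(tn+fp) + p(1)·tp/(tp+fn). -/
theorem ha_eq_weighted_rates
    {X : Type*} [Fintype X]
    (c : X → Bool) (hclass : ∀ l : Bool, ∃ x : X, c x = l)
    (score : X → Bool → ℝ) (hscore : ∀ x l, score x l ∈ Set.Icc (0 : ℝ) 1)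
    (argmax : X → Bool)
    (hmax : ∀ x l, score x l ≤ score x (argmax x))
    (huniq : ∀ x l, score x l = score x (argmax x) → l = argmax x)
    (p : Bool → ℝ) (hp01 : ∀ l, p l ∈ Set.Icc (0 : ℝ) 1) (hp : p false + p true = 1)
    (d : X → ℝ) (κ : ℝ) (hκ : 0 < κ) (hκ1 : κ ≤ 1) (hd : ∀ x, d x = κ) :
    -- H-accuracy at τ = 1/2
    (∑ l : Bool, p l *
        ∑ x ∈ univ.filter (fun x => c x = l),
          (d x / ∑ x' ∈ univ.filter (fun x' => c x' = l), d x') *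
            (if score x (argmax x) ≤ score x l then (1 : ℝ) else 0))
      =
    p false * ((confCount c argmax false false : ℝ) /
        ((confCount c argmax false false : ℝ) + (confCount c argmax false true : ℝ)))
      + p true * ((confCount c argmax true true : ℝ) /
        ((confCount c argmax true true : ℝ) + (confCount c argmax true false : ℝ))) := by
  have key := class_rate c hclass score argmax hmax huniq d κ hκ hd
  rw [Fintype.sum_bool, key true, key false, Bool.not_true, Bool.not_false]
  ring
end

section
/- Let C be a finite set of classes with |C| = k ≥ 2, S a finite dataset with every class nonempty, c : S → C the true-class function, and m a scoring model whose class scores on each instance sum to 1. For any priorities p : C → [0,1] with Σ p(l) = 1, any complexities d : S → (0,1], and any thresholds 1/k < τ1 ≤ τ2 ≤ 1, the H-accuracy is monotone non-increasing in the confidence threshold: Ha(m | τ2, p, d) ≤ Ha(m | τ1, p, d). -/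
open Finset

/-- The penalty function σ(s | τ) for a k-class task, where `M` is the maximal class
score on the instance: 0 if s < M; (s − 1/k)/(τ − 1/k) if M ≤ s ≤ τ; 1 if s > τ. -/
noncomputable def sigmaPen (k : ℕ) (M τ s : ℝ) : ℝ :=
  if s < M then 0
  else if s ≤ τ then (s - 1 / (k : ℝ)) / (τ - 1 / (k : ℝ))
  else 1

/-- The maximal score assigned by the model to any class on instance `x`. -/
noncomputable def maxScore {X C : Type*} [Fintype C] [Nonempty C]
    (score : X → C → ℝ) (x : X) : ℝ :=
  univ.sup' univ_nonempty (score x)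

/-- The H-accuracy Ha(m | τ, p, d). -/
noncomputable def Ha {X C : Type*} [Fintype X] [Fintype C] [DecidableEq C] [Nonempty C]
    (k : ℕ) (c : X → C) (score : X → C → ℝ) (p : C → ℝ) (d : X → ℝ) (τ : ℝ) : ℝ :=
  ∑ l : C, p l *
    ∑ x ∈ univ.filter (fun x => c x = l),
      (d x / ∑ x' ∈ univ.filter (fun x' => c x' = l), d x') *
        sigmaPen k (maxScore score x) τ (score x l)

theorem sigmaPen_anti (k : ℕ) (M τ1 τ2 s : ℝ) (hτ1 : 1 / (k : ℝ) < τ1) (h12 : τ1 ≤ τ2)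
    (hs : M ≤ s → 1 / (k : ℝ) ≤ s) : sigmaPen k M τ2 s ≤ sigmaPen k M τ1 s := by
  unfold sigmaPen
  by_cases h : s < M
  · simp [h]
  · have hs' := hs (not_lt.mp h)
    rw [if_neg h, if_neg h]
    split_ifs with h2 h1 h1
    · exact div_le_div_of_nonneg_left (by linarith) (by linarith) (by linarith)
    · rw [div_le_one (by linarith)]
      linarith
    · linarith
    · exact le_refl _

/-- the H-accuracy is monotone non-increasing in the confidence
threshold τ. -/
theorem ha_antitone_in_tau
    {X C : Type*} [Fintype X] [Fintype C] [DecidableEq C] [Nonempty C]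
    (k : ℕ) (hk : 2 ≤ k) (hC : Fintype.card C = k)
    (c : X → C) (hclass : ∀ l : C, ∃ x : X, c x = l)
    (score : X → C → ℝ) (hscore : ∀ x l, score x l ∈ Set.Icc (0 : ℝ) 1)
    (hsum : ∀ x, ∑ l : C, score x l = 1)
    (p : C → ℝ) (hp01 : ∀ l, p l ∈ Set.Icc (0 : ℝ) 1) (hp : ∑ l : C, p l = 1)
    (d : X → ℝ) (hd : ∀ x, d x ∈ Set.Ioc (0 : ℝ) 1)
    (τ1 τ2 : ℝ) (hτ1 : 1 / (k : ℝ) < τ1) (h12 : τ1 ≤ τ2) (hτ2 : τ2 ≤ 1) :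
    Ha k c score p d τ2 ≤ Ha k c score p d τ1 := by
  unfold Ha
  refine Finset.sum_le_sum fun l _ => mul_le_mul_of_nonneg_left ?_ (hp01 l).1
  refine Finset.sum_le_sum fun x _ => mul_le_mul_of_nonneg_left ?_
    (div_nonneg (hd x).1.le (Finset.sum_nonneg fun y _ => (hd y).1.le))
  refine sigmaPen_anti k _ τ1 τ2 _ hτ1 h12 fun hM => ?_
  have hle : ∀ l' ∈ (univ : Finset C), score x l' ≤ score x l := fun l' hl' =>
    (Finset.le_sup' (score x) hl').trans hM
  have h1 := Finset.sum_le_card_nsmul _ _ _ hle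
  rw [hsum x, Finset.card_univ, hC, nsmul_eq_mul] at h1
  have hk0 : (0 : ℝ) < k := by
    have : 0 < k := by omega
    exact_mod_cast this
  rw [div_le_iff₀ hk0]
  linarith
end
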